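/- Let v* ∈ ℝ^d be a unit vector, λ > 0, Σ := λ v* v*ᵀ + I_d, let Σ̂ be a symmetric positive semidefinite d×d matrix, and W := Σ̂ − Σ. Let F ⊆ ℝ^d be a linear subspace with v* ∈ F, suppose λ > 2ρ(W, F), let P_F be the orthogonal projection onto F, Σ̂_F := P_F Σ̂ P_F, let λ₁^F ≥ λ₂^F be the two largest eigenvalues of Σ̂_F and κ̂ := λ₂^F / λ₁^F, and let v̂_F be a unit eigenvector of Σ̂_F for the eigenvalue λ₁^F with ⟨v̂_F, v*⟩ ≥ 0. Let v_t be a unit vector with α_t := ⟨v_t, v̂_F⟩ > 0 and Σ̂_F v_t ≠ 0, and set v' := Σ̂_F v_t / ‖Σ̂_F v_t‖₂. Then ‖v̂_F − v'‖₂ ≤ (κ̂/α_t) · ‖v_t − v*‖₂ + (κ̂/α_t) · ρ(W, F)/(λ − 2ρ(W, F)). -/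

import Mathlib

open MeasureTheory ProbabilityTheory Matrix Finset

noncomputable section

namespace StructuredPCA

/-- Euclidean inner product on `Fin d → ℝ`. -/
def ip {d : ℕ} (u v : Fin d → ℝ) : ℝ := ∑ i, u i * v i

/-- Euclidean norm on `Fin d → ℝ`. -/
def nrm {d : ℕ} (v : Fin d → ℝ) : ℝ := Real.sqrt (∑ i, v i ^ 2)

/-- Quadratic form `vᵀ A v`. -/
def quad {d : ℕ} (A : Matrix (Fin d) (Fin d) ℝ) (v : Fin d → ℝ) : ℝ := ip v (A.mulVec v)

/-- `ρ(A, S) = sup { |vᵀ A v| : v ∈ S, ‖v‖ = 1 }`. -/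
def rho {d : ℕ} (A : Matrix (Fin d) (Fin d) ℝ) (S : Set (Fin d → ℝ)) : ℝ :=
  sSup {x : ℝ | ∃ v ∈ S, nrm v = 1 ∧ x = |quad A v|}

/-- Frobenius norm of a matrix. -/
def frob {d : ℕ} (A : Matrix (Fin d) (Fin d) ℝ) : ℝ :=
  Real.sqrt (∑ i, ∑ j, A i j ^ 2)

/-- Operator (spectral) norm of a matrix. -/
def opNorm {d : ℕ} (A : Matrix (Fin d) (Fin d) ℝ) : ℝ :=
  sSup {x : ℝ | ∃ v, nrm v = 1 ∧ x = nrm (A.mulVec v)}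

/-- The spiked covariance `λ v* v*ᵀ + I`. -/
def spikedCov {d : ℕ} (lam : ℝ) (vstar : Fin d → ℝ) : Matrix (Fin d) (Fin d) ℝ :=
  lam • vecMulVec vstar vstar + 1

/-- `x 1, …, x n` are spiked Wishart samples with spike `v*`:
`x i = √λ g i • v* + z i` with `g, z` i.i.d. standard normal, mutually independent. -/
def IsSpikedWishart {d n : ℕ} {Ω : Type*} [MeasurableSpace Ω] (μ : Measure Ω)
    (lam : ℝ) (vstar : Fin d → ℝ) (x : Fin n → Ω → Fin d → ℝ) : Prop :=
  ∃ G : (Fin n ⊕ Fin n × Fin d) → Ω → ℝ,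
    (∀ i, Measurable (G i)) ∧
    iIndepFun G μ ∧
    (∀ i, μ.map (G i) = gaussianReal 0 1) ∧
    ∀ i ω j, x i ω j = Real.sqrt lam * G (Sum.inl i) ω * vstar j + G (Sum.inr (i, j)) ω

/-- The sample covariance matrix `n⁻¹ ∑ xᵢ xᵢᵀ`. -/
def sampleCov {d n : ℕ} {Ω : Type*} (x : Fin n → Ω → Fin d → ℝ) (ω : Ω) :
    Matrix (Fin d) (Fin d) ℝ :=
  (n : ℝ)⁻¹ • ∑ i, vecMulVec (x i ω) (x i ω)

/-- Union-of-linear-structures data: an orthonormal basis `φ` and subsets `Bs m`. -/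
structure UnionStruct (d M : ℕ) where
  φ : Fin d → Fin d → ℝ
  orthonormal : ∀ i j, ip (φ i) (φ j) = if i = j then 1 else 0
  Bs : Fin M → Finset (Fin d)

/-- The subspace `L m = span (B m)`. -/
def UnionStruct.L {d M : ℕ} (U : UnionStruct d M) (m : Fin M) : Submodule ℝ (Fin d → ℝ) :=
  Submodule.span ℝ (U.φ '' (U.Bs m : Set (Fin d)))

/-- The union `𝓜 = ⋃ m, L m`. -/
def UnionStruct.carrier {d M : ℕ} (U : UnionStruct d M) : Set (Fin d → ℝ) :=
  ⋃ m, (U.L m : Set (Fin d → ℝ))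

/-- A `(d,k)`-layered graph. -/
structure LayeredGraph (d k : ℕ) where
  vs : Fin d
  vt : Fin d
  hst : vs ≠ vt
  V : Fin k → Finset (Fin d)
  hvs : ∀ j, vs ∉ V j
  hvt : ∀ j, vt ∉ V j
  hdisj : ∀ j j', j ≠ j' → Disjoint (V j) (V j')
  hdvd : k ∣ (d - 2)
  hcard : ∀ j, (V j).card = (d - 2) / k
  hcover : ∀ i, i ≠ vs → i ≠ vt → ∃ j, i ∈ V j

/-- A member of `P^k`: contains `v_s`, `v_t` and exactly one vertex of each layer. -/
def LayeredGraph.IsPathSet {d k : ℕ} (G : LayeredGraph d k) (P : Finset (Fin d)) : Prop :=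
  G.vs ∈ P ∧ G.vt ∈ P ∧ ∀ j, (P ∩ G.V j).card = 1

/-- `v` is `k`-path-sparse. -/
def LayeredGraph.PathSparse {d k : ℕ} (G : LayeredGraph d k) (v : Fin d → ℝ) : Prop :=
  ∃ P, G.IsPathSet P ∧ ∀ i, v i ≠ 0 → i ∈ P

/-- A member of `T^k`: a `k`-element rooted connected subtree of the complete binary
tree on nodes `1, …, d` (node `i ≥ 2` has parent `i / 2`). -/
def IsTreeSet (d k : ℕ) (T : Finset ℕ) : Prop :=
  T.card = k ∧ 1 ∈ T ∧ (∀ i ∈ T, 1 ≤ i ∧ i ≤ d) ∧ ∀ i ∈ T, 2 ≤ i → i / 2 ∈ T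

/-- `v` is `k`-tree-sparse (coordinate `i : Fin d` corresponds to node `i + 1`). -/
def TreeSparse (d k : ℕ) (v : Fin d → ℝ) : Prop :=
  ∃ T, IsTreeSet d k T ∧ ∀ i : Fin d, v i ≠ 0 → (i : ℕ) + 1 ∈ T

/-- The index of the parent node: coordinate `i` is node `i+1`, whose parent is `(i+1)/2`. -/
def parentIdx {d : ℕ} (i : Fin d) : Fin d :=
  ⟨((i : ℕ) + 1) / 2 - 1, by have := i.isLt; omega⟩

/-- The feasible set of the SDP relaxation for tree-sparse PCA. -/
def sdpFeasible (d k : ℕ) : Set (Matrix (Fin d) (Fin d) ℝ) :=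
  {Mm | Mm.PosSemidef ∧ (∑ i, Mm i i) = 1 ∧ (∑ i, ∑ j, |Mm i j|) ≤ (k : ℝ) ∧
    ∀ i : Fin d, 2 ≤ (i : ℕ) + 1 → Mm i i ≤ Mm (parentIdx i) (parentIdx i)}


lemma le_of_sq_aux {a b : ℝ} (h : a ^ 2 ≤ b ^ 2) (hb : 0 ≤ b) : a ≤ b :=
  abs_le_of_sq_le_sq' h hb |>.2

lemma ip_eq {d : ℕ} (u v : Fin d → ℝ) : ip u v = u ⬝ᵥ v := rfl

lemma ip_comm {d : ℕ} (u v : Fin d → ℝ) : ip u v = ip v u := by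
  simp only [ip_eq, dotProduct_comm]

lemma ip_add_l {d : ℕ} (u v w : Fin d → ℝ) : ip (u + v) w = ip u w + ip v w := by
  simp only [ip_eq, add_dotProduct]

lemma ip_add_r {d : ℕ} (u v w : Fin d → ℝ) : ip w (u + v) = ip w u + ip w v := by
  simp only [ip_eq, dotProduct_add]

lemma ip_sub_l {d : ℕ} (u v w : Fin d → ℝ) : ip (u - v) w = ip u w - ip v w := by
  simp only [ip_eq, sub_dotProduct]

lemma ip_sub_r {d : ℕ} (u v w : Fin d → ℝ) : ip w (u - v) = ip w u - ip w v := by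
  simp only [ip_eq, dotProduct_sub]

lemma ip_smul_l {d : ℕ} (c : ℝ) (u w : Fin d → ℝ) : ip (c • u) w = c * ip u w := by
  simp only [ip_eq, smul_dotProduct, smul_eq_mul]

lemma ip_smul_r {d : ℕ} (c : ℝ) (u w : Fin d → ℝ) : ip w (c • u) = c * ip w u := by
  simp only [ip_eq, dotProduct_smul, smul_eq_mul]

lemma ip_symm {d : ℕ} {A : Matrix (Fin d) (Fin d) ℝ} (hA : A.IsSymm) (x y : Fin d → ℝ) :
    ip x (A.mulVec y) = ip (A.mulVec x) y := by
  rw [ip_eq, ip_eq, dotProduct_mulVec, ← mulVec_transpose, hA.eq]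

lemma nrm_nonneg {d : ℕ} (v : Fin d → ℝ) : 0 ≤ nrm v := Real.sqrt_nonneg _

lemma nrm_sq {d : ℕ} (v : Fin d → ℝ) : nrm v ^ 2 = ip v v := by
  unfold nrm ip
  rw [Real.sq_sqrt (Finset.sum_nonneg fun i _ => sq_nonneg _)]
  exact Finset.sum_congr rfl fun i _ => by ring

lemma nrm_eq_zero {d : ℕ} {v : Fin d → ℝ} (h : nrm v = 0) : v = 0 := by
  have h2 := nrm_sq v
  rw [h, ip_eq] at h2
  exact dotProduct_self_eq_zero.mp (by linarith)

lemma nrm_smul {d : ℕ} (c : ℝ) (v : Fin d → ℝ) : nrm (c • v) = |c| * nrm v := by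
  rw [← abs_of_nonneg (nrm_nonneg (c • v)), ← abs_of_nonneg (nrm_nonneg v), ← abs_mul,
    ← sq_eq_sq_iff_abs_eq_abs, mul_pow, nrm_sq, nrm_sq, ip_smul_l, ip_smul_r]
  ring

lemma quad_smul {d : ℕ} (A : Matrix (Fin d) (Fin d) ℝ) (c : ℝ) (v : Fin d → ℝ) :
    quad A (c • v) = c ^ 2 * quad A v := by
  unfold quad
  rw [mulVec_smul, ip_smul_l, ip_smul_r]
  ring

/-- unit vector bound extends by homogeneity -/
lemma homog {d : ℕ} (A : Matrix (Fin d) (Fin d) ℝ) (S : Submodule ℝ (Fin d → ℝ)) (r : ℝ)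
    (h : ∀ v ∈ S, nrm v = 1 → |quad A v| ≤ r) (v : Fin d → ℝ) (hv : v ∈ S) :
    |quad A v| ≤ r * nrm v ^ 2 := by
  by_cases h0 : nrm v = 0
  · have := nrm_eq_zero h0
    rw [h0, this]
    simp [quad, ip]
  · have hp : 0 < nrm v := lt_of_le_of_ne (nrm_nonneg v) (Ne.symm h0)
    have h1 := h ((nrm v)⁻¹ • v) (S.smul_mem _ hv) (by
      rw [nrm_smul, abs_of_pos (inv_pos.mpr hp)]
      exact inv_mul_cancel₀ h0)
    rw [quad_smul, abs_mul, abs_of_nonneg (sq_nonneg _), inv_pow, inv_mul_le_iff₀ (by positivity)]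
      at h1
    linarith

lemma polar {d : ℕ} {A : Matrix (Fin d) (Fin d) ℝ} (hA : A.IsSymm)
    (S : Submodule ℝ (Fin d → ℝ)) (r : ℝ)
    (h : ∀ v ∈ S, nrm v = 1 → |quad A v| ≤ r) (x y : Fin d → ℝ) (hx : x ∈ S) (hy : y ∈ S) :
    ip x (A.mulVec y) ≤ r * (nrm x * nrm y) := by
  have key : ∀ x ∈ S, ∀ y ∈ S, 2 * ip x (A.mulVec y) ≤ r * (nrm x ^ 2 + nrm y ^ 2) := by
    intro x hx y hy
    have h1 := (abs_le.mp (homog A S r h (x + y) (S.add_mem hx hy))).2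
    have h2 := (abs_le.mp (homog A S r h (x - y) (S.sub_mem hx hy))).1
    have hs : ip y (A.mulVec x) = ip x (A.mulVec y) := by rw [ip_symm hA, ip_comm]
    have hc : ip y x = ip x y := ip_comm _ _
    rw [nrm_sq] at h1 h2 ⊢
    rw [nrm_sq]
    simp only [quad, mulVec_add, mulVec_sub, ip_add_l, ip_add_r, ip_sub_l, ip_sub_r, hs, hc]
      at h1 h2
    linarith
  by_cases hx0 : nrm x = 0
  · rw [hx0, nrm_eq_zero hx0]
    simp [ip]
  by_cases hy0 : nrm y = 0
  · rw [hy0, nrm_eq_zero hy0]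
    simp [ip]
  have hxp : 0 < nrm x := lt_of_le_of_ne (nrm_nonneg x) (Ne.symm hx0)
  have hyp : 0 < nrm y := lt_of_le_of_ne (nrm_nonneg y) (Ne.symm hy0)
  have := key (nrm y • x) (S.smul_mem _ hx) (nrm x • y) (S.smul_mem _ hy)
  rw [mulVec_smul, ip_smul_l, ip_smul_r, nrm_smul, nrm_smul, abs_of_pos hxp, abs_of_pos hyp] at this
  have hm : 0 < nrm x * nrm y := mul_pos hxp hyp
  refine le_of_mul_le_mul_left ?_ hm
  nlinarith [this]

lemma nrm_eq_norm {d : ℕ} (v : Fin d → ℝ) : nrm v = ‖(WithLp.toLp 2 v : EuclideanSpace ℝ (Fin d))‖ := by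
  rw [EuclideanSpace.norm_eq]
  simp [nrm]

lemma nrm_add_le {d : ℕ} (u v : Fin d → ℝ) : nrm (u + v) ≤ nrm u + nrm v := by
  simp only [nrm_eq_norm, WithLp.toLp_add]
  exact norm_add_le _ _

lemma quad_bdd {d : ℕ} (A : Matrix (Fin d) (Fin d) ℝ) (v : Fin d → ℝ) (hv : nrm v = 1) :
    |quad A v| ≤ ∑ i, ∑ j, |A i j| := by
  have hi : ∀ i, |v i| ≤ 1 := by
    intro i
    rw [← sq_le_one_iff_abs_le_one]
    have h1 : nrm v ^ 2 = ∑ i, v i ^ 2 := by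
      unfold nrm
      rw [Real.sq_sqrt (Finset.sum_nonneg fun i _ => sq_nonneg _)]
    have h2 := Finset.single_le_sum (f := fun i => v i ^ 2) (fun i _ => sq_nonneg _)
      (Finset.mem_univ i)
    rw [hv] at h1
    linarith
  unfold quad ip
  refine (Finset.abs_sum_le_sum_abs _ _).trans (Finset.sum_le_sum fun i _ => ?_)
  rw [abs_mul]
  refine (mul_le_of_le_one_left (abs_nonneg _) (hi i)).trans ?_
  simp only [mulVec, dotProduct]
  refine (Finset.abs_sum_le_sum_abs _ _).trans (Finset.sum_le_sum fun j _ => ?_)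
  rw [abs_mul]
  exact mul_le_of_le_one_right (abs_nonneg _) (hi j)

lemma le_rho {d : ℕ} (A : Matrix (Fin d) (Fin d) ℝ) (S : Set (Fin d → ℝ)) (v : Fin d → ℝ)
    (hvS : v ∈ S) (hv : nrm v = 1) : |quad A v| ≤ rho A S := by
  refine le_csSup ⟨∑ i, ∑ j, |A i j|, ?_⟩ ⟨v, hvS, hv, rfl⟩
  rintro x ⟨w, -, hw, rfl⟩
  exact quad_bdd A w hw

/-- the scalar inequality `2 sin (θ/2) ≤ tan θ`, in vector form -/
lemma final_step {d : ℕ} (e m : Fin d → ℝ) (a : ℝ) (ha : 0 < a) (he : nrm e = 1)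
    (hem : ip e m = 0) :
    nrm (e - (nrm (a • e + m))⁻¹ • (a • e + m)) ≤ nrm m / a := by
  have hee : ip e e = 1 := by rw [← nrm_sq, he]; norm_num
  have hme : ip m e = 0 := by rw [ip_comm, hem]
  set N := nrm (a • e + m) with hN
  have hN2 : N ^ 2 = a ^ 2 + nrm m ^ 2 := by
    rw [hN, nrm_sq, nrm_sq]
    simp only [ip_add_l, ip_add_r, ip_smul_l, ip_smul_r, hee, hem, hme]
    ring
  have hNa : a ≤ N := by
    refine le_of_sq_aux ?_ (nrm_nonneg _)
    nlinarith [sq_nonneg (nrm m)]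
  have hNp : 0 < N := lt_of_lt_of_le ha hNa
  have hL : nrm (e - N⁻¹ • (a • e + m)) ^ 2 = 2 - 2 * a / N := by
    have h1 : ip (a • e + m) (a • e + m) = N ^ 2 := by rw [hN, nrm_sq]
    have h2 : ip e (a • e + m) = a := by
      simp only [ip_add_r, ip_smul_r, hee, hem]; ring
    have h3 : ip (a • e + m) e = a := by rw [ip_comm, h2]
    rw [nrm_sq, ip_sub_l, ip_sub_r, ip_sub_r, ip_smul_l, ip_smul_l, ip_smul_r, ip_smul_r, h1, h2,
      h3, hee]
    field_simp
    ring
  refine le_of_sq_aux ?_ (div_nonneg (nrm_nonneg _) ha.le)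
  rw [hL, div_pow, show nrm m ^ 2 = N ^ 2 - a ^ 2 by linarith]
  rw [← sub_nonneg]
  have : (N ^ 2 - a ^ 2) / a ^ 2 - (2 - 2 * a / N) = (N - a) ^ 2 * (N + 2 * a) / (a ^ 2 * N) := by
    field_simp
    ring
  rw [this]
  positivity

/-- one-step distance lemma: with `v' = Σ̂_F v_t / ‖Σ̂_F v_t‖`,
`‖v̂_F − v'‖ ≤ (κ̂/α_t)‖v_t − v*‖ + (κ̂/α_t) ρ(W,F)/(λ − 2ρ(W,F))`. -/
theorem distance_to_restricted_eigvec
    {d : ℕ} (vstar : Fin d → ℝ) (hvstar_nrm : nrm vstar = 1)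
    (lam : ℝ) (hlam : 0 < lam)
    (Sighat : Matrix (Fin d) (Fin d) ℝ) (hpsd : Sighat.PosSemidef)
    (W : Matrix (Fin d) (Fin d) ℝ) (hW : W = Sighat - spikedCov lam vstar)
    (F : Submodule ℝ (Fin d → ℝ)) (hvstarF : vstar ∈ F)
    (hgap : 2 * rho W (F : Set (Fin d → ℝ)) < lam)
    (P : Matrix (Fin d) (Fin d) ℝ) (hPsymm : P.IsSymm)
    (hPrange : ∀ w : Fin d → ℝ, P.mulVec w ∈ F)
    (hPfix : ∀ w ∈ F, P.mulVec w = w)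
    (lam1 lam2 : ℝ)
    (hlam1 : lam1 = sSup {x : ℝ | ∃ v : Fin d → ℝ, nrm v = 1 ∧ x = quad (P * Sighat * P) v})
    (vF : Fin d → ℝ) (hvF_nrm : nrm vF = 1)
    (hvF_eig : (P * Sighat * P).mulVec vF = lam1 • vF)
    (hvF_pos : 0 ≤ ip vF vstar)
    (hlam2 : lam2 = sSup {x : ℝ |
        ∃ v : Fin d → ℝ, nrm v = 1 ∧ ip v vF = 0 ∧ x = quad (P * Sighat * P) v})
    (vt : Fin d → ℝ) (hvt_nrm : nrm vt = 1)
    (alphat : ℝ) (halphat : alphat = ip vt vF) (halphat_pos : 0 < alphat)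
    (hnz : (P * Sighat * P).mulVec vt ≠ 0) :
    nrm (vF - (nrm ((P * Sighat * P).mulVec vt))⁻¹ • (P * Sighat * P).mulVec vt) ≤
      (lam2 / lam1) / alphat * nrm (vt - vstar) +
        (lam2 / lam1) / alphat *
          (rho W (F : Set (Fin d → ℝ)) / (lam - 2 * rho W (F : Set (Fin d → ℝ)))) := by
  set r := rho W (F : Set (Fin d → ℝ)) with hr
  have hr0 : 0 ≤ r := by
    apply Real.sSup_nonneg
    rintro x ⟨v, -, -, rfl⟩
    exact abs_nonneg _
  have hSsymm : Sighat.IsSymm := by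
    have := hpsd.1
    rwa [Matrix.IsHermitian, conjTranspose_eq_transpose_of_trivial] at this
  have hSnn : ∀ x, 0 ≤ ip x (Sighat.mulVec x) := by
    intro x
    have := hpsd.dotProduct_mulVec_nonneg x
    simpa [ip_eq] using this
  have hvs1 : ip vstar vstar = 1 := by rw [← nrm_sq, hvstar_nrm]; norm_num
  have hvF1 : ip vF vF = 1 := by rw [← nrm_sq, hvF_nrm]; norm_num
  have hvt1 : ip vt vt = 1 := by rw [← nrm_sq, hvt_nrm]; norm_num
  have hSW : ∀ x y, ip x (Sighat.mulVec y) =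
      lam * (ip x vstar * ip vstar y) + ip x y + ip x (W.mulVec y) := by
    intro x y
    have : Sighat = spikedCov lam vstar + W := by rw [hW]; abel
    rw [this, add_mulVec, ip_add_r, spikedCov, add_mulVec, ip_add_r, one_mulVec, smul_mulVec,
      ip_smul_r]
    have h2 : (vecMulVec vstar vstar).mulVec y = ip vstar y • vstar := by
      ext i
      simp [vecMulVec_mulVec, ip_eq, mul_comm]
    rw [h2, ip_smul_r]
    ring
  have hWsymm : W.IsSymm := by
    rw [hW]
    refine hSsymm.sub ?_
    rw [spikedCov, Matrix.IsSymm, transpose_add, transpose_smul, transpose_one, transpose_vecMulVec]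
  set M := P * Sighat * P with hM
  have hMsymm : M.IsSymm := by
    rw [Matrix.IsSymm, hM, transpose_mul, transpose_mul, hPsymm.eq, hSsymm.eq, Matrix.mul_assoc]
  have hMip : ∀ x y, ip x (M.mulVec y) = ip (P.mulVec x) (Sighat.mulVec (P.mulVec y)) := by
    intro x y
    rw [hM, ← mulVec_mulVec, ← mulVec_mulVec, ip_symm hPsymm]
  have hMnn : ∀ x, 0 ≤ quad M x := fun x => by rw [quad, hMip]; exact hSnn _
  have hMF : ∀ x, M.mulVec x ∈ F := fun x => by
    rw [hM, ← mulVec_mulVec, ← mulVec_mulVec]; exact hPrange _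
  -- lower bound for lam1
  have hl1 : lam + 1 - r ≤ lam1 := by
    have h1 : quad M vstar ≤ lam1 := by
      rw [hlam1]
      refine le_csSup ⟨∑ i, ∑ j, |M i j|, ?_⟩ ⟨vstar, hvstar_nrm, rfl⟩
      rintro x ⟨w, hw, rfl⟩
      exact (le_abs_self _).trans (quad_bdd M w hw)
    have h2 : quad M vstar = lam + 1 + quad W vstar := by
      rw [quad, hMip, hPfix _ hvstarF, hSW, hvs1, quad]; ring
    have h3 := (abs_le.mp (le_rho W F vstar hvstarF hvstar_nrm)).1
    linarith
  have hl1p : 0 < lam1 := by linarith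
  have hvFF : vF ∈ F := by
    have : vF = lam1⁻¹ • M.mulVec vF := by
      rw [hvF_eig, smul_smul, inv_mul_cancel₀ hl1p.ne', one_smul]
    rw [this]
    exact F.smul_mem _ (hMF _)
  -- Davis-Kahan
  set c := ip vF vstar with hc
  have hc' : ip vstar vF = c := by rw [ip_comm]
  have hsin : nrm (vstar - c • vF) ≤ r / (lam - 2 * r) := by
    set y := vF - c • vstar with hy
    have hyF : y ∈ F := F.sub_mem hvFF (F.smul_mem _ hvstarF)
    have hyv : ip y vstar = 0 := by rw [hy, ip_sub_l, ip_smul_l, hvs1]; ring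
    have hyvF : ip y vF = 1 - c ^ 2 := by rw [hy, ip_sub_l, ip_smul_l, hvF1, hc']; ring
    have hy2 : nrm y ^ 2 = 1 - c ^ 2 := by
      rw [nrm_sq]; nth_rw 2 [hy]; rw [ip_sub_r, ip_smul_r, hyv, hyvF]; ring
    have hz2 : nrm (vstar - c • vF) ^ 2 = 1 - c ^ 2 := by
      rw [nrm_sq]; simp only [ip_sub_l, ip_sub_r, ip_smul_l, ip_smul_r, hvs1, hvF1, hc', ← hc]; ring
    have hyz : nrm (vstar - c • vF) = nrm y := by
      have : nrm (vstar - c • vF) ^ 2 = nrm y ^ 2 := by rw [hy2, hz2]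
      exact (sq_eq_sq₀ (nrm_nonneg _) (nrm_nonneg _)).mp this
    have e1 : ip y (M.mulVec vF) = lam1 * nrm y ^ 2 := by
      rw [hvF_eig, ip_smul_r, hyvF, hy2]
    have e2 : ip y (M.mulVec vF) = nrm y ^ 2 + ip y (W.mulVec vF) := by
      rw [hMip, hPfix _ hyF, hPfix _ hvFF, hSW, hyv, hyvF, hy2]; ring
    have e3 := polar hWsymm F r (fun v hv h1 => le_rho W F v hv h1) y vF hyF hvFF
    rw [hvF_nrm] at e3
    rw [hyz, le_div_iff₀ (by linarith)]
    by_cases h0 : nrm y = 0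
    · rw [h0]; linarith
    have hp : 0 < nrm y := lt_of_le_of_ne (nrm_nonneg y) (Ne.symm h0)
    have e4 : (lam1 - 1) * nrm y ≤ r := by
      refine le_of_mul_le_mul_right ?_ hp
      nlinarith
    nlinarith
  -- decomposition of vt
  set z := vt - alphat • vF with hz
  have hzF : ip z vF = 0 := by rw [hz, ip_sub_l, ip_smul_l, hvF1, halphat]; ring
  have hzn : nrm z ≤ nrm (vt - vstar) + r / (lam - 2 * r) := by
    set u := vt - vstar with hu
    have h1 : z = (u - ip u vF • vF) + (vstar - c • vF) := by
      have : ip u vF = alphat - c := by rw [hu, ip_sub_l, hc', halphat]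
      rw [this, hz, hu, sub_smul]; abel
    have h2 : nrm (u - ip u vF • vF) ≤ nrm u := by
      refine le_of_sq_aux ?_ (nrm_nonneg _)
      rw [nrm_sq, nrm_sq]
      have : ip vF u = ip u vF := ip_comm _ _
      simp only [ip_sub_l, ip_sub_r, ip_smul_l, ip_smul_r, hvF1, this]
      nlinarith [sq_nonneg (ip u vF)]
    rw [h1]
    exact (nrm_add_le _ _).trans (add_le_add h2 hsin)
  have hl2 : 0 ≤ lam2 := by
    rw [hlam2]
    apply Real.sSup_nonneg
    rintro x ⟨v, -, -, rfl⟩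
    exact hMnn v
  have hMzF : ip (M.mulVec z) vF = 0 := by
    rw [← ip_symm hMsymm, hvF_eig, ip_smul_r, hzF, mul_zero]
  have hMz : nrm (M.mulVec z) ≤ lam2 * nrm z := by
    let S : Submodule ℝ (Fin d → ℝ) :=
      { carrier := {v | ip v vF = 0}
        add_mem' := by
          intro a b ha hb
          simp only [Set.mem_setOf_eq] at *
          rw [ip_add_l, ha, hb, add_zero]
        zero_mem' := by simp [ip]
        smul_mem' := by
          intro k a ha
          simp only [Set.mem_setOf_eq] at *
          rw [ip_smul_l, ha, mul_zero] }
    have hS : ∀ v ∈ S, nrm v = 1 → |quad M v| ≤ lam2 := by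
      intro v hv h1
      rw [abs_of_nonneg (hMnn v), hlam2]
      refine le_csSup ⟨∑ i, ∑ j, |M i j|, ?_⟩ ⟨v, h1, hv, rfl⟩
      rintro x ⟨w, hw, -, rfl⟩
      exact (le_abs_self _).trans (quad_bdd M w hw)
    have := polar hMsymm S lam2 hS (M.mulVec z) z hMzF hzF
    rw [← nrm_sq] at this
    by_cases h0 : nrm (M.mulVec z) = 0
    · rw [h0]; exact mul_nonneg hl2 (nrm_nonneg _)
    have hp : 0 < nrm (M.mulVec z) := lt_of_le_of_ne (nrm_nonneg _) (Ne.symm h0)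
    refine le_of_mul_le_mul_right ?_ hp
    nlinarith
  have hdec : M.mulVec vt = (alphat * lam1) • vF + M.mulVec z := by
    rw [hz, mulVec_sub, mulVec_smul, hvF_eig, smul_smul]; abel
  have hap : 0 < alphat * lam1 := mul_pos halphat_pos hl1p
  rw [hdec, ← mul_add]
  refine (final_step vF (M.mulVec z) _ hap hvF_nrm (by rw [ip_comm, hMzF])).trans ?_
  rw [div_le_iff₀ hap]
  refine hMz.trans ((mul_le_mul_of_nonneg_left hzn hl2).trans (le_of_eq ?_))
  have hl1n := hl1p.ne'
  have han := halphat_pos.ne'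
  generalize nrm (vt - vstar) + r / (lam - 2 * r) = T
  field_simp

end StructuredPCA
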